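/- arXiv:2508.17978 — 2 statements merged into one kernel-verified Lean document; each statement's English description precedes it below -/
import Mathlib

section
/- Let N ≥ 2, let λ_1, …, λ_N be strictly positive reals summing to one, and let w_0, w_1, …, w_N be differentiable probability weighting functions. For a profile (P^1, …, P^N) ∈ Δ^N define the ex ante social utility U^0_a(x) := Σ_{t=0}^∞ δ_a(t) x_t, where δ_a(t) := Σ_{n=1}^N λ_n Σ_{m=1}^M β_m^t (w_n(P^n_1 + ⋯ + P^n_m) − w_n(P^n_1 + ⋯ + P^n_{m−1})), and the ex post social utility U^0_p(x) := Σ_{m=1}^M (w_0(P^0_1 + ⋯ + P^0_m) − w_0(P^0_1 + ⋯ + P^0_{m−1})) ⟨β_m, x⟩, where P^0 := Σ_{n=1}^N λ_n P^n. Then U^0_a(x) = U^0_p(x) for every project x and every profile (P^1, …, P^N) ∈ Δ^N if and only if w_n(p) = p for every p ∈ [0,1] and every n = 0, 1, …, N. -/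
open MeasureTheory Set

noncomputable section

/-- A project: a finitely supported sequence of nonnegative payoffs. -/
def IsProject (x : ℕ → ℝ) : Prop :=
  (Function.support x).Finite ∧ ∀ t, 0 ≤ x t

/-- Discounted value `⟨β, x⟩ = Σ_t β^t x_t`. -/
def dv (β : ℝ) (x : ℕ → ℝ) : ℝ := ∑' t, β ^ t * x t

/-- A probability weighting function on `[0,1]`. -/
def IsWeighting (w : ℝ → ℝ) : Prop :=
  ContinuousOn w (Icc 0 1) ∧ StrictMonoOn w (Icc 0 1) ∧
  MapsTo w (Icc 0 1) (Icc 0 1) ∧ w 0 = 0 ∧ w 1 = 1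

/-- Cumulative probability `P_1 + ⋯ + P_m`. -/
def cumul {M : ℕ} (P : Fin M → ℝ) (m : Fin M) : ℝ := ∑ i ∈ Finset.Iic m, P i

/-- Cumulative probability `P_1 + ⋯ + P_{m-1}` (empty sum is 0). -/
def cumulLt {M : ℕ} (P : Fin M → ℝ) (m : Fin M) : ℝ := ∑ i ∈ Finset.Iio m, P i

/-- Rank-dependent utility of a project. -/
def RDU {M : ℕ} (β P : Fin M → ℝ) (w : ℝ → ℝ) (x : ℕ → ℝ) : ℝ :=
  ∑ m, (w (cumul P m) - w (cumulLt P m)) * dv (β m) x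

/-- The distribution on `Fin (k + 2)` with mass `p` at `0` and mass `1 - p` at `1`. -/
def twoPoint (k : ℕ) (p : ℝ) (i : Fin (k + 2)) : ℝ :=
  if i = 0 then p else if i = 1 then 1 - p else 0

theorem sum_twoPoint {k : ℕ} {p : ℝ} {s : Finset (Fin (k + 2))} (h0 : 0 ∈ s) (h1 : 1 ∈ s) :
    ∑ i ∈ s, twoPoint k p i = 1 := by
  have hsub : ({0, 1} : Finset (Fin (k + 2))) ⊆ s := by
    simp [Finset.insert_subset_iff, h0, h1]
  rw [← Finset.sum_subset hsub, Finset.sum_pair (by simp)]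
  · simp [twoPoint]
  · intro i _ hi
    simp only [Finset.mem_insert, Finset.mem_singleton, not_or] at hi
    simp [twoPoint, hi]

theorem twoPoint_mem_stdSimplex (k : ℕ) {p : ℝ} (hp : p ∈ Icc (0 : ℝ) 1) :
    twoPoint k p ∈ stdSimplex ℝ (Fin (k + 2)) := by
  refine ⟨fun i => ?_, sum_twoPoint (Finset.mem_univ _) (Finset.mem_univ _)⟩
  unfold twoPoint
  split_ifs
  · exact hp.1
  · exact sub_nonneg.2 hp.2
  · exact le_rfl

theorem sum_weights_twoPoint {k : ℕ} {W : ℝ → ℝ} (W0 : W 0 = 0) (W1 : W 1 = 1) (p : ℝ)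
    (b : Fin (k + 2) → ℝ) :
    ∑ m, b m * (W (cumul (twoPoint k p) m) - W (cumulLt (twoPoint k p) m))
      = b 1 + (b 0 - b 1) * W p := by
  have c0 : cumul (twoPoint k p) 0 = p := by
    have : (Finset.Iic 0 : Finset (Fin (k + 2))) = {0} := by ext i; simp
    simp [cumul, this, twoPoint]
  have c1 : cumul (twoPoint k p) 1 = 1 := sum_twoPoint (by simp) (by simp)
  have l0 : cumulLt (twoPoint k p) 0 = 0 := by
    have : (Finset.Iio 0 : Finset (Fin (k + 2))) = ∅ := by ext i; simp
    simp [cumulLt, this]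
  have l1 : cumulLt (twoPoint k p) 1 = p := by
    have : (Finset.Iio 1 : Finset (Fin (k + 2))) = {0} := by
      ext i; simp [Fin.lt_one_iff]
    simp [cumulLt, this, twoPoint]
  have tail (j : Fin k) : cumul (twoPoint k p) j.succ.succ = 1 ∧
      cumulLt (twoPoint k p) j.succ.succ = 1 := by
    constructor <;> refine sum_twoPoint ?_ ?_ <;> simp [Fin.lt_def, Fin.le_def, -Fin.val_fin_lt, -Fin.val_fin_le]
  rw [Fin.sum_univ_succ, Fin.sum_univ_succ]
  simp only [Fin.succ_zero_eq_one, c0, c1, l0, l1, tail, W0, W1, sub_self, mul_zero,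
    Finset.sum_const_zero]
  ring

theorem sum_mul_twoPoint {k N : ℕ} {lam : Fin N → ℝ} (hsum : ∑ n, lam n = 1) (p : Fin N → ℝ) :
    (fun i => ∑ n, lam n * twoPoint k (p n) i) = twoPoint k (∑ n, lam n * p n) := by
  funext i
  unfold twoPoint
  split_ifs
  · rfl
  · simp [mul_sub, Finset.sum_sub_distrib, hsum]
  · simp

/-- A weighting function differentiable at `0` that is additive between the parts `l • [0,1]` and
`(1 - l) • [0,1]` of the unit interval is the identity. -/
theorem eq_self_of_additive {f : ℝ → ℝ} {l : ℝ} (hl : l ∈ Ioo (0 : ℝ) 1)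
    (hc : ContinuousOn f (Icc 0 1)) (hd : DifferentiableWithinAt ℝ f (Icc 0 1) 0)
    (f0 : f 0 = 0) (f1 : f 1 = 1)
    (hadd : ∀ a ∈ Icc 0 l, ∀ q ∈ Icc 0 (1 - l), f (a + q) = f a + f q) :
    ∀ p ∈ Icc (0 : ℝ) 1, f p = p := by
  obtain ⟨l0, l1⟩ := hl
  set D := derivWithin f (Icc 0 1) 0
  have hD : HasDerivWithinAt f D (Ici 0) 0 :=
    hd.hasDerivWithinAt.mono_of_mem_nhdsWithin (Icc_mem_nhdsGE one_pos)
  have right (x : ℝ) (hx : x ∈ Ico (0 : ℝ) 1) : HasDerivWithinAt f D (Ici x) x := by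
    have hshift : HasDerivWithinAt (fun y => f x + f (y - x)) D (Ici x) x := by
      have hi : HasDerivWithinAt (fun y : ℝ => y - x) 1 (Ici x) x :=
        ((hasDerivAt_id x).sub_const x).hasDerivWithinAt
      have hD' : HasDerivWithinAt f D (Ici 0) (x - x) := by simpa using hD
      have := hD'.comp (h := fun y => y - x) x hi (fun y (hy : x ≤ y) => sub_nonneg.2 hy)
      simpa [Function.comp_def] using this.const_add (f x)
    obtain ⟨x0, x1⟩ := hx
    have hε : 0 < min l ((1 - l) * (1 - x)) :=
      lt_min l0 (mul_pos (by linarith) (by linarith))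
    refine hshift.congr_of_eventuallyEq ?_ (by simp [f0])
    filter_upwards [Icc_mem_nhdsGE (lt_add_of_pos_right x hε)] with y hy
    have h1 : y - x ≤ l := by linarith [hy.2, min_le_left l ((1 - l) * (1 - x))]
    have h2 : y - x ≤ (1 - l) * (1 - x) := by
      linarith [hy.2, min_le_right l ((1 - l) * (1 - x))]
    have h0 : 0 ≤ y - x := sub_nonneg.2 hy.1
    have ha : l * x ∈ Icc 0 l := ⟨by positivity, by nlinarith⟩
    have hqx : 0 ≤ (1 - l) * x := mul_nonneg (by linarith) x0
    have e1 := hadd _ ha ((1 - l) * x) ⟨hqx, by nlinarith⟩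
    have e2 := hadd _ ha ((1 - l) * x + (y - x)) ⟨by linarith, by linarith⟩
    have e3 := hadd (y - x) ⟨h0, h1⟩ ((1 - l) * x) ⟨hqx, by nlinarith⟩
    rw [show l * x + ((1 - l) * x + (y - x)) = y by ring] at e2
    rw [show l * x + (1 - l) * x = x by ring] at e1
    rw [show y - x + (1 - l) * x = (1 - l) * x + (y - x) by ring] at e3
    linarith
  have key := constant_of_has_deriv_right_zero (f := fun x => f x - D * x) (a := 0) (b := 1)
    (hc.sub (by fun_prop)) (fun x hx => by
      simpa [Pi.sub_def] using (right x hx).sub ((hasDerivWithinAt_id x (Ici x)).const_mul D))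
  have h1 := key 1 (by simp)
  intro p hp
  have h2 := key p hp
  simp only [f0, f1, mul_zero, mul_one, sub_zero] at h1 h2
  have : D = 1 := by linarith
  rw [this] at h2
  linarith

theorem cumul_mem_Icc {M : ℕ} {P : Fin M → ℝ} (hP : P ∈ stdSimplex ℝ (Fin M)) (m : Fin M) :
    cumul P m ∈ Icc (0 : ℝ) 1 :=
  ⟨Finset.sum_nonneg fun i _ => hP.1 i,
    hP.2 ▸ Finset.sum_le_univ_sum_of_nonneg hP.1⟩

theorem cumulLt_mem_Icc {M : ℕ} {P : Fin M → ℝ} (hP : P ∈ stdSimplex ℝ (Fin M)) (m : Fin M) :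
    cumulLt P m ∈ Icc (0 : ℝ) 1 :=
  ⟨Finset.sum_nonneg fun i _ => hP.1 i,
    hP.2 ▸ Finset.sum_le_univ_sum_of_nonneg hP.1⟩

theorem cumul_sub_cumulLt {M : ℕ} (P : Fin M → ℝ) (m : Fin M) :
    cumul P m - cumulLt P m = P m := by
  unfold cumul cumulLt
  rw [← Finset.Iio_insert, Finset.sum_insert (by simp)]
  ring


theorem stmt3 (N M : ℕ) (hN : 2 ≤ N) (hM : 2 ≤ M)
    (β : Fin M → ℝ) (hβmem : ∀ m, β m ∈ Icc (0:ℝ) 1) (hβ : StrictAnti β)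
    (lam : Fin N → ℝ) (hlam : ∀ n, 0 < lam n) (hsum : ∑ n, lam n = 1)
    (w0 : ℝ → ℝ) (w : Fin N → ℝ → ℝ)
    (hw0 : IsWeighting w0) (hw : ∀ n, IsWeighting (w n))
    (hw0d : DifferentiableOn ℝ w0 (Icc 0 1))
    (hwd : ∀ n, DifferentiableOn ℝ (w n) (Icc 0 1)) :
    -- ex ante utility `Σ_t δ_a(t) x_t` agrees with the ex post RDU with
    -- aggregate distribution `P^0 = Σ_n λ_n P^n` for all profiles and projects
    (∀ P : Fin N → Fin M → ℝ, (∀ n, P n ∈ stdSimplex ℝ (Fin M)) →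
      ∀ x : ℕ → ℝ, IsProject x →
        (∑' t : ℕ, (∑ n, lam n * ∑ m, β m ^ t *
            (w n (cumul (P n) m) - w n (cumulLt (P n) m))) * x t)
          = RDU β (fun i => ∑ n, lam n * P n i) w0 x)
    ↔ ((∀ p ∈ Icc (0:ℝ) 1, w0 p = p) ∧ ∀ n, ∀ p ∈ Icc (0:ℝ) 1, w n p = p) := by
  constructor
  · intro h
    obtain ⟨k, rfl⟩ : ∃ k, M = k + 2 := ⟨M - 2, by omega⟩
    have agg (p : Fin N → ℝ) (hp : ∀ n, p n ∈ Icc (0 : ℝ) 1) :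
        ∑ n, lam n * w n (p n) = w0 (∑ n, lam n * p n) := by
      have hx : IsProject (Pi.single 1 1) :=
        ⟨(finite_singleton 1).subset Pi.support_single_subset,
          fun t => by by_cases ht : t = 1 <;> simp [ht]⟩
      have hdv (b : ℝ) : dv b (Pi.single 1 1) = b := by
        rw [dv, tsum_eq_single 1 (fun t ht => by simp [ht])]
        simp
      have e := h (fun n => twoPoint k (p n)) (fun n => twoPoint_mem_stdSimplex k (hp n)) _ hx
      rw [tsum_eq_single 1 (fun t ht => by simp [ht]), RDU, sum_mul_twoPoint hsum] at e
      simp only [hdv, pow_one, Pi.single_eq_same, mul_one] at e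
      have eL (n : Fin N) := sum_weights_twoPoint (hw n).2.2.2.1 (hw n).2.2.2.2 (p n) β
      have eR := sum_weights_twoPoint hw0.2.2.2.1 hw0.2.2.2.2 (∑ n, lam n * p n) β
      simp only [mul_comm (β _)] at eL eR e
      simp only [eL, eR, mul_add, Finset.sum_add_distrib, ← Finset.sum_mul, hsum, one_mul,
        add_right_inj, mul_left_comm (lam _), ← Finset.mul_sum] at e
      exact mul_left_cancel₀ (sub_ne_zero.2 (hβ (by simp)).ne') e
    have single (n : Fin N) (p : ℝ) (hp : p ∈ Icc (0 : ℝ) 1) :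
        lam n * w n p = w0 (lam n * p) := by
      have e := agg (Pi.single n p) fun i => by
        by_cases hi : i = n
        · subst hi; simpa using hp
        · simp [hi]
      rw [Finset.sum_eq_single n, Finset.sum_eq_single n] at e
      · simpa using e
      all_goals simp +contextual [(hw _).2.2.2.1]
    have hid : ∀ p ∈ Icc (0 : ℝ) 1, w0 p = p := by
      let i : Fin N := ⟨0, by omega⟩
      let j : Fin N := ⟨1, by omega⟩
      have hrest : ∑ n ∈ Finset.univ.erase i, lam n = 1 - lam i := by
        rw [← hsum, ← Finset.add_sum_erase _ _ (Finset.mem_univ i)]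
        ring
      have hlt : lam i < 1 := by
        have : 0 < ∑ n ∈ Finset.univ.erase i, lam n :=
          Finset.sum_pos (fun n _ => hlam n) ⟨j, by simp [i, j]⟩
        linarith
      refine eq_self_of_additive ⟨hlam i, hlt⟩ hw0.1 (hw0d 0 (by simp)) hw0.2.2.2.1
        hw0.2.2.2.2 fun a ha q hq => ?_
      have hl := hlam i
      have hl' : 0 < 1 - lam i := sub_pos.2 hlt
      have hr : q / (1 - lam i) ∈ Icc (0 : ℝ) 1 :=
        ⟨div_nonneg hq.1 hl'.le, (div_le_one hl').2 hq.2⟩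
      have hs : a / lam i ∈ Icc (0 : ℝ) 1 := ⟨div_nonneg ha.1 hl.le, (div_le_one hl).2 ha.2⟩
      have expand (s : ℝ) (hs : s ∈ Icc (0 : ℝ) 1) :
          lam i * w i s + ∑ n ∈ Finset.univ.erase i, lam n * w n (q / (1 - lam i))
            = w0 (lam i * s + q) := by
        have e := agg (Function.update (fun _ => q / (1 - lam i)) i s) fun n => by
          by_cases hn : n = i
          · subst hn; simpa using hs
          · simpa [hn] using hr
        rw [← Finset.add_sum_erase _ _ (Finset.mem_univ i),
          ← Finset.add_sum_erase _ _ (Finset.mem_univ i)] at e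
        have upd (F : Fin N → ℝ → ℝ) :
            ∑ n ∈ Finset.univ.erase i, F n (Function.update (fun _ => q / (1 - lam i)) i s n)
              = ∑ n ∈ Finset.univ.erase i, F n (q / (1 - lam i)) :=
          Finset.sum_congr rfl fun n hn => by simp [Finset.ne_of_mem_erase hn]
        rw [upd fun n y => lam n * w n y, upd fun n y => lam n * y,
          ← Finset.sum_mul, hrest, mul_div_cancel₀ _ hl'.ne', Function.update_self] at e
        exact e
      have e1 := expand _ hs
      have e2 := expand 0 (by simp)
      rw [single i _ hs, mul_div_cancel₀ _ hl.ne'] at e1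
      rw [(hw i).2.2.2.1, mul_zero, zero_add, zero_add] at e2
      rw [← e1, e2]
    refine ⟨hid, fun n p hp => mul_left_cancel₀ (hlam n).ne' ?_⟩
    have hle : lam n ≤ 1 := hsum ▸ Finset.single_le_sum (fun i _ => (hlam i).le)
      (Finset.mem_univ n)
    rw [single n p hp, hid _ ⟨mul_nonneg (hlam n).le hp.1, mul_le_one₀ hle hp.1 hp.2⟩]
  · rintro ⟨h0, hn⟩ P hP x ⟨hx, -⟩
    have hP0 : (fun i => ∑ n, lam n * P n i) ∈ stdSimplex ℝ (Fin M) := by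
      refine ⟨fun i => Finset.sum_nonneg fun n _ => mul_nonneg (hlam n).le ((hP n).1 i), ?_⟩
      rw [Finset.sum_comm]
      simp only [← Finset.mul_sum, (hP _).2, mul_one, hsum]
    have hsupp (g : ℕ → ℝ) : ∑' t, g t * x t = ∑ t ∈ hx.toFinset, g t * x t :=
      tsum_eq_sum fun t ht => by simp_all
    simp only [RDU, dv, hsupp, h0 _ (cumul_mem_Icc hP0 _), h0 _ (cumulLt_mem_Icc hP0 _),
      hn _ _ (cumul_mem_Icc (hP _) _), hn _ _ (cumulLt_mem_Icc (hP _) _), cumul_sub_cumulLt]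
    simp only [Finset.mul_sum, Finset.sum_mul]
    rw [Finset.sum_comm (s := Finset.univ) (t := hx.toFinset)]
    refine Finset.sum_congr rfl fun t _ => ?_
    rw [Finset.sum_comm]
    refine Finset.sum_congr rfl fun m _ => Finset.sum_congr rfl fun n _ => ?_
    ring
end
end

section
/- Let M ≥ 3 and 1 > β_1 > β_2 > ⋯ > β_M > 0. There exist a menu D consisting of M + 1 pairwise distinct projects and a project x ∈ D with the following property: for every vector b ∈ (0,1)^M such that, writing c_m := (Σ_{j≠m} b_j − (M−2) b_m)/(M−1), one has c_m > 0 for all m = 1, …, M and Σ_{m=1}^M c_m < 1, there exists a nonatomic Borel probability measure υ ∈ Ω such that for every P ∈ Δ the random choice rule ρ induced by (P, υ) satisfies ρ(x, D) = Σ_{m=1}^M P_m b_m. -/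
open MeasureTheory Set

noncomputable section

/-- `M(D, β)`: the elements of `D` with maximal discounted value at discount factor `β`. -/
def MaxSet (D : Set (ℕ → ℝ)) (β : ℝ) : Set (ℕ → ℝ) :=
  {x ∈ D | ∀ y ∈ D, dv β y ≤ dv β x}

/-- A tie-breaker: a nonatomic Borel probability measure on `[0,1]`. -/
structure TieBreaker where
  μ : Measure ↥(Icc (0:ℝ) 1)
  prob : IsProbabilityMeasure μ
  noAtoms : ∀ γ : ↥(Icc (0:ℝ) 1), μ {γ} = 0

/-- The random choice rule induced by `(P, υ)`:
`ρ(x, D) = Σ_m P_m · υ{γ : x ∈ M(M(D, β_m), γ)}`. -/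
def rcr {M : ℕ} (β P : Fin M → ℝ) (υ : TieBreaker) (x : ℕ → ℝ)
    (D : Finset (ℕ → ℝ)) : ℝ :=
  ∑ m, P m *
    (υ.μ {γ : ↥(Icc (0:ℝ) 1) | x ∈ MaxSet (MaxSet (↑D) (β m)) (γ : ℝ)}).toReal

lemma dv_coeff (β : ℝ) (p : Polynomial ℝ) : dv β p.coeff = p.eval β := by
  rw [dv, tsum_eq_sum (s := p.support), Polynomial.eval_eq_sum, Polynomial.sum]
  · exact Finset.sum_congr rfl fun t _ => mul_comm _ _
  · intro t ht
    simp [Polynomial.notMem_support_iff.mp ht]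

lemma isProject_coeff {p : Polynomial ℝ} (hp : ∀ t, 0 ≤ p.coeff t) : IsProject p.coeff :=
  ⟨p.support.finite_toSet.subset fun t ht => by simpa using ht, hp⟩

lemma exists_coeff_eq_abs (p : Polynomial ℝ) :
    ∃ q : Polynomial ℝ, ∀ t, q.coeff t = |p.coeff t| := by
  refine ⟨∑ i ∈ p.support, Polynomial.monomial i |p.coeff i|, fun t => ?_⟩
  simp +contextual [Polynomial.finsetSum_coeff, Polynomial.coeff_monomial]

/-- Finitely many polynomials can be shifted by a common one to have nonnegative coefficients. -/
lemma exists_add_coeff_nonneg {ι : Type*} [Fintype ι] (e : ι → Polynomial ℝ) :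
    ∃ B : Polynomial ℝ, ∀ k t, 0 ≤ (B + e k).coeff t := by
  choose q hq using fun k => exists_coeff_eq_abs (e k)
  refine ⟨∑ k, q k, fun k t => ?_⟩
  rw [Polynomial.coeff_add, Polynomial.finsetSum_coeff]
  have h : |(e k).coeff t| ≤ ∑ i, (q i).coeff t := by
    simp only [hq]
    exact Finset.single_le_sum (f := fun i => |(e i).coeff t|) (fun i _ => abs_nonneg _)
      (Finset.mem_univ k)
  linarith [neg_abs_le ((e k).coeff t)]

lemma exists_polynomial_eval_eq {ι : Type*} [Fintype ι] [DecidableEq ι] {v : ι → ℝ}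
    (hv : Function.Injective v) (r : ι → ℝ) : ∃ p : Polynomial ℝ, ∀ i, p.eval (v i) = r i :=
  ⟨Lagrange.interpolate Finset.univ v r, fun i =>
    Lagrange.eval_interpolate_at_node r hv.injOn (Finset.mem_univ i)⟩

lemma mem_maxSet_maxSet_iff {D : Set (ℕ → ℝ)} {x y : ℕ → ℝ} {b : ℝ} (hx : x ∈ D) (hy : y ∈ D)
    (hxy : dv b y = dv b x) (hD : ∀ z ∈ D, z = x ∨ z = y ∨ dv b z < dv b x) (γ : ℝ) :
    x ∈ MaxSet (MaxSet D b) γ ↔ dv γ y ≤ dv γ x := by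
  have hle : ∀ z ∈ D, dv b z ≤ dv b x := fun z hz => by
    rcases hD z hz with rfl | rfl | h
    exacts [le_rfl, hxy.le, h.le]
  refine ⟨fun h => h.2 y ⟨hy, fun z hz => hxy ▸ hle z hz⟩, fun h => ⟨⟨hx, hle⟩, fun z hz => ?_⟩⟩
  rcases hD z hz.1 with rfl | rfl | h'
  exacts [le_rfl, h, absurd (hz.2 x hx) h'.not_ge]

lemma volume_unitInterval_ne_zero {U : Set unitInterval} (hU : IsOpen U) (hne : U.Nonempty) :
    volume U ≠ 0 := by
  obtain ⟨V, hV, rfl⟩ := isOpen_induced_iff.mp hU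
  obtain ⟨γ, hγ⟩ := hne
  have hcl : (γ : ℝ) ∈ closure (Ioo (0:ℝ) 1) := by
    rw [closure_Ioo zero_ne_one]
    exact γ.2
  have hpos : 0 < volume (V ∩ Ioo (0:ℝ) 1) :=
    (hV.inter isOpen_Ioo).measure_pos volume (mem_closure_iff.mp hcl V hV hγ)
  rw [unitInterval.volume_apply]
  refine (hpos.trans_le (measure_mono fun x hx => ?_)).ne'
  exact ⟨⟨x, Ioo_subset_Icc_self hx.2⟩, hx.1, rfl⟩

/-- A mixture, with given weights, of nonatomic distributions concentrated on given open sets. -/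
lemma exists_tieBreaker {ι : Type*} [Fintype ι] (U : ι → Set ↥(Icc (0:ℝ) 1))
    (hU : ∀ k, IsOpen (U k)) (hne : ∀ k, (U k).Nonempty) (c : ι → ℝ) (hc : ∀ k, 0 ≤ c k)
    (hsum : ∑ k, c k = 1) :
    ∃ υ : TieBreaker, ∀ (A : Set ↥(Icc (0:ℝ) 1)) (s : Finset ι), (∀ k ∈ s, U k ⊆ A) →
      (∀ k ∉ s, Disjoint (U k) A) → (υ.μ A).toReal = ∑ k ∈ s, c k := by
  have hpos : ∀ k, (volume : Measure unitInterval) (U k) ≠ 0 := fun k =>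
    volume_unitInterval_ne_zero (hU k) (hne k)
  set ν : ι → Measure ↥(Icc (0:ℝ) 1) :=
    fun k => ProbabilityTheory.cond (volume : Measure unitInterval) (U k)
  have hprob : ∀ k, IsProbabilityMeasure (ν k) := fun k =>
    ProbabilityTheory.cond_isProbabilityMeasure (hpos k)
  have hone : ∀ k, ν k (U k) = 1 := fun k =>
    ProbabilityTheory.cond_apply_self (hpos k) (measure_ne_top _ _)
  have happ : ∀ A, (∑ k, ENNReal.ofReal (c k) • ν k) A = ∑ k, ENNReal.ofReal (c k) * ν k A :=
    fun A => by simp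
  refine ⟨⟨∑ k, ENNReal.ofReal (c k) • ν k, ⟨?_⟩, fun γ => ?_⟩, fun A s hs hs' => ?_⟩
  · rw [happ]
    simp only [measure_univ, mul_one]
    rw [← ENNReal.ofReal_sum_of_nonneg fun k _ => hc k, hsum, ENNReal.ofReal_one]
  · rw [happ]
    refine Finset.sum_eq_zero fun k _ => ?_
    rw [ProbabilityTheory.cond_absolutelyContinuous
      (measure_singleton (μ := (volume : Measure unitInterval)) γ), mul_zero]
  · classical
    have hA : ∀ k, ENNReal.ofReal (c k) * ν k A = if k ∈ s then ENNReal.ofReal (c k) else 0 := by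
      intro k
      split_ifs with hk
      · rw [le_antisymm prob_le_one ((hone k).symm.le.trans (measure_mono (hs k hk))), mul_one]
      · have h0 : ν k (U k)ᶜ = 0 := (prob_compl_eq_zero_iff (hU k).measurableSet).mpr (hone k)
        rw [measure_mono_null (hs' k hk).subset_compl_left h0, mul_zero]
    change ((∑ k, ENNReal.ofReal (c k) • ν k) A).toReal = _
    rw [happ, Finset.sum_congr rfl fun k _ => hA k, Finset.sum_ite_mem, Finset.univ_inter,
      ← ENNReal.ofReal_sum_of_nonneg fun k _ => hc k,
      ENNReal.toReal_ofReal (Finset.sum_nonneg fun k _ => hc k)]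

/-- Points of the open unit interval avoiding a finite family. -/
lemma exists_injective_avoiding {ι κ : Type*} [Finite ι] [Countable κ] (β : ι → ℝ) :
    ∃ g : κ → ℝ, Function.Injective g ∧ (∀ k, g k ∈ Ioo (0:ℝ) 1) ∧ ∀ i k, β i ≠ g k := by
  have hinf : (Ioo (0:ℝ) 1 \ range β).Infinite :=
    (Ioo_infinite one_pos).sdiff (finite_range β)
  obtain ⟨f, hf⟩ := exists_injective_nat κ
  have := hinf.to_subtype
  let e := Infinite.natEmbedding ↥(Ioo (0:ℝ) 1 \ range β)
  exact ⟨fun k => e (f k), Subtype.val_injective.comp (e.injective.comp hf),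
    fun k => (e (f k)).2.1, fun i k h => (e (f k)).2.2 ⟨i, h⟩⟩

/-- Deviation polynomials `d m` vanishing at `β m`, negative at the other `β j`, with prescribed
signs at extra points `g k` of the unit interval: positive at `g none` and `g (some m)`,
negative at the other `g (some j)`. -/
lemma exists_deviations {M : ℕ} {β : Fin M → ℝ} (hβ : Function.Injective β) :
    ∃ (g : Option (Fin M) → ℝ) (d : Fin M → Polynomial ℝ), (∀ k, g k ∈ Ioo (0:ℝ) 1) ∧
      (∀ m, (d m).eval (β m) = 0) ∧ (∀ m j, j ≠ m → (d m).eval (β j) < 0) ∧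
      (∀ m, 0 < (d m).eval (g none)) ∧ (∀ m, 0 < (d m).eval (g (some m))) ∧
      ∀ m j, j ≠ m → (d m).eval (g (some j)) < 0 := by
  obtain ⟨g, hg, hmem, hne⟩ := exists_injective_avoiding (κ := Option (Fin M)) β
  have hv : Function.Injective (Sum.elim β g) := hβ.sumElim hg hne
  choose d hd using fun m : Fin M => exists_polynomial_eval_eq hv
    (Sum.elim (fun j => if j = m then 0 else -1)
      (fun k => k.elim 1 fun j => if j = m then 1 else -1))
  refine ⟨g, d, hmem, fun m => ?_, fun m j h => ?_, fun m => ?_, fun m => ?_, fun m j h => ?_⟩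
  · simpa using hd m (.inl m)
  · have := hd m (.inl j)
    simp only [Sum.elim_inl, if_neg h] at this
    linarith
  · have := hd m (.inr none)
    simp only [Sum.elim_inr, Option.elim_none] at this
    linarith
  · have := hd m (.inr (some m))
    simp only [Sum.elim_inr, Option.elim_some, if_true] at this
    linarith
  · have := hd m (.inr (some j))
    simp only [Sum.elim_inr, Option.elim_some, if_neg h] at this
    linarith

lemma sum_erase_weights {M : ℕ} (hM : (M : ℝ) - 1 ≠ 0) (b : Fin M → ℝ) (m : Fin M) :
    ∑ i ∈ Finset.univ.erase m,
      ((∑ j ∈ Finset.univ.erase i, b j) - ((M:ℝ) - 2) * b i) / ((M:ℝ) - 1) = b m := by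
  have h : ∀ i, ((∑ j ∈ Finset.univ.erase i, b j) - ((M:ℝ) - 2) * b i) / ((M:ℝ) - 1) =
      (∑ j, b j) / ((M:ℝ) - 1) - b i := fun i => by
    rw [Finset.sum_erase_eq_sub (Finset.mem_univ i)]
    field_simp
    ring
  simp only [h]
  rw [Finset.sum_erase_eq_sub (Finset.mem_univ m), Finset.sum_sub_distrib]
  simp only [Finset.sum_const, Finset.card_univ, Fintype.card_fin, nsmul_eq_mul]
  field_simp
  ring

theorem stmt6 (M : ℕ) (hM : 3 ≤ M)
    (β : Fin M → ℝ) (hβmem : ∀ m, β m ∈ Ioo (0:ℝ) 1) (hβ : StrictAnti β) :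
    ∃ (D : Finset (ℕ → ℝ)) (x : ℕ → ℝ),
      D.card = M + 1 ∧ (∀ y ∈ D, IsProject y) ∧ x ∈ D ∧
      ∀ b : Fin M → ℝ, (∀ m, b m ∈ Ioo (0:ℝ) 1) →
        (∀ m : Fin M,
          0 < ((∑ j ∈ Finset.univ.erase m, b j) - ((M:ℝ) - 2) * b m) / ((M:ℝ) - 1)) →
        (∑ m, ((∑ j ∈ Finset.univ.erase m, b j) - ((M:ℝ) - 2) * b m) / ((M:ℝ) - 1)) < 1 →
        ∃ υ : TieBreaker, ∀ P ∈ stdSimplex ℝ (Fin M),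
          rcr β P υ x D = ∑ m, P m * b m := by
  obtain ⟨g, d, hg, hd0, hdneg, hnone, hsome, hother⟩ := exists_deviations hβ.injective
  let e : Option (Fin M) → Polynomial ℝ := fun k => k.elim 0 d
  obtain ⟨B, hB⟩ := exists_add_coeff_nonneg e
  have he : Function.Injective e := by
    rintro (_ | i) (_ | j) h
    · rfl
    · have : (d j).eval (g none) = 0 := by simpa [e] using congrArg (·.eval (g none)) h.symm
      exact absurd this (hnone j).ne'
    · have : (d i).eval (g none) = 0 := by simpa [e] using congrArg (·.eval (g none)) h
      exact absurd this (hnone i).ne'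
    · by_contra hij
      have hij' : i ≠ j := fun h' => hij (congrArg some h')
      have h1 : (d i).eval (β i) = (d j).eval (β i) := congrArg (·.eval (β i)) h
      linarith [hd0 i, hdneg j i hij']
  let Y : Option (Fin M) → ℕ → ℝ := fun k => (B + e k).coeff
  have hY : Function.Injective Y := fun k l h =>
    he (add_left_cancel (Polynomial.coeff_injective h))
  have hdv : ∀ γ k, dv γ (Y k) = B.eval γ + (e k).eval γ := fun γ k => by
    rw [dv_coeff, Polynomial.eval_add]
  have hmem : ∀ k, Y k ∈ Finset.univ.map ⟨Y, hY⟩ := fun k =>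
    Finset.mem_map_of_mem ⟨Y, hY⟩ (Finset.mem_univ k)
  refine ⟨Finset.univ.map ⟨Y, hY⟩, Y none, by simp, ?_, hmem none, ?_⟩
  · intro y hy
    obtain ⟨k, -, rfl⟩ := Finset.mem_map.mp hy
    exact isProject_coeff (hB k)
  intro b _ hc hcsum
  have hchosen : ∀ m γ, Y none ∈ MaxSet (MaxSet ↑(Finset.univ.map ⟨Y, hY⟩) (β m)) γ ↔
      (d m).eval γ ≤ 0 := by
    intro m γ
    rw [mem_maxSet_maxSet_iff (y := Y (some m)) (Finset.mem_coe.mpr (hmem none))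
      (Finset.mem_coe.mpr (hmem (some m)))]
    · simp [hdv, e]
    · simp [hdv, e, hd0]
    · intro z hz
      obtain ⟨k, -, rfl⟩ := Finset.mem_map.mp (Finset.mem_coe.mp hz)
      rcases k with _ | j
      · exact Or.inl rfl
      · by_cases hj : j = m
        · exact Or.inr (Or.inl (by rw [hj]; rfl))
        · refine Or.inr (Or.inr ?_)
          have := hdneg j m (Ne.symm hj)
          simpa [hdv, e] using this
  let U : Option (Fin M) → Set ↥(Icc (0:ℝ) 1) := fun k =>
    {γ | ∀ m, 0 < (d m).eval (g k) * (d m).eval (γ : ℝ)}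
  have hU : ∀ k, IsOpen (U k) := fun k => by
    simp only [U, ofPred_forall]
    exact isOpen_iInter_of_finite fun m => isOpen_lt continuous_const
      (continuous_const.mul ((d m).continuous.comp continuous_subtype_val))
  have hne : ∀ k, (U k).Nonempty := fun k => by
    refine ⟨⟨g k, Ioo_subset_Icc_self (hg k)⟩, fun m => mul_self_pos.mpr ?_⟩
    rcases k with _ | j
    · exact (hnone m).ne'
    · by_cases hj : j = m
      · exact hj ▸ (hsome j).ne'
      · exact (hother m j hj).ne
  let c : Fin M → ℝ := fun m =>
    ((∑ j ∈ Finset.univ.erase m, b j) - ((M:ℝ) - 2) * b m) / ((M:ℝ) - 1)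
  obtain ⟨υ, hυ⟩ := exists_tieBreaker U hU hne (fun k => k.elim (1 - ∑ m, c m) c)
    (by
      rintro (_ | m)
      · exact sub_nonneg.mpr hcsum.le
      · exact (hc m).le)
    (by simp [Fintype.sum_option])
  refine ⟨υ, fun P _ => Finset.sum_congr rfl fun m _ => ?_⟩
  have hM' : (M : ℝ) - 1 ≠ 0 := by
    have : (3 : ℝ) ≤ M := by exact_mod_cast hM
    linarith
  congr 1
  simp only [hchosen]
  rw [hυ _ ((Finset.univ.erase m).map Function.Embedding.some), Finset.sum_map]
  · exact sum_erase_weights hM' b m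
  · intro k hk γ hγ
    obtain ⟨j, hj, rfl⟩ := Finset.mem_map.mp hk
    exact (neg_of_mul_pos_right (hγ m) (hother m j (Finset.ne_of_mem_erase hj)).le).le
  · intro k hk
    have hpos : 0 < (d m).eval (g k) := by
      rcases k with _ | j
      · exact hnone m
      · by_cases hj : j = m
        · exact hj ▸ hsome j
        · exact absurd (Finset.mem_map_of_mem Function.Embedding.some
            (Finset.mem_erase.mpr ⟨hj, Finset.mem_univ j⟩)) hk
    exact Set.disjoint_left.mpr fun γ hγ => not_le.mpr (pos_of_mul_pos_right (hγ m) hpos.le)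
end
end
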